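/- Suppose {e_n} are i.i.d. random variables whose common distribution has a continuous, bounded and strictly positive density on ℝ, and let {y_n} be the unique strictly stationary solution of the TMA(q) model. Then there exist constants ρ ∈ (0,1) and C > 0 such that for all −∞ ≤ u1 < u2 ≤ ∞, −∞ ≤ v1 < v2 ≤ ∞ and all integers k ≥ 1, |Cov(1(u1 < y_0 ≤ u2), 1(v1 < y_k ≤ v2))| ≤ C·ρ^k. -/

import Mathlib

open MeasureTheory ProbabilityTheory Filter Finset

/-- The σ-algebra generated by the variables `e j`, `j ∈ S`. -/
@[reducible] def noiseSigma {Ω : Type*} (e : ℤ → Ω → ℝ) (S : Set ℤ) : MeasurableSpace Ω :=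
  ⨆ j ∈ S, MeasurableSpace.comap (e j) inferInstance

lemma measurable_noiseSigma {Ω : Type*} (e : ℤ → Ω → ℝ) {S : Set ℤ} {j : ℤ} (hj : j ∈ S) :
    Measurable[noiseSigma e S] (e j) :=
  measurable_iff_comap_le.2 (le_iSup₂_of_le j hj le_rfl)

lemma noiseSigma_mono {Ω : Type*} (e : ℤ → Ω → ℝ) {S T : Set ℤ} (h : S ⊆ T) :
    noiseSigma e S ≤ noiseSigma e T :=
  biSup_mono h

lemma measureReal_inter_of_noiseSigma {Ω : Type*} {mΩ : MeasurableSpace Ω} {μ : Measure Ω}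
    {e : ℤ → Ω → ℝ} (he : ∀ n, Measurable (e n)) (hindep : iIndepFun e μ) {S T : Set ℤ}
    (hST : Disjoint S T) {s t : Set Ω} (hs : MeasurableSet[noiseSigma e S] s)
    (ht : MeasurableSet[noiseSigma e T] t) :
    μ.real (s ∩ t) = μ.real s * μ.real t := by
  have h := indep_iSup_of_disjoint (fun i => (he i).comap_le) hindep.iIndep hST
  simp only [Measure.real, ← ENNReal.toReal_mul]
  rw [(Indep_iff _ _ _).1 h s t hs ht]

lemma abs_measureReal_sub_le_of_iff {Ω : Type*} {mΩ : MeasurableSpace Ω} {μ : Measure Ω}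
    [IsFiniteMeasure μ] {s s' A : Set Ω} (hs : ∀ ω ∉ A, (ω ∈ s ↔ ω ∈ s')) :
    |μ.real s - μ.real s'| ≤ μ.real A := by
  have h1 : μ.real s ≤ μ.real s' + μ.real A :=
    (measureReal_mono (fun ω h => by
      by_cases hA : ω ∈ A
      · exact Or.inr hA
      · exact Or.inl ((hs ω hA).1 h))).trans (measureReal_union_le s' A)
  have h2 : μ.real s' ≤ μ.real s + μ.real A :=
    (measureReal_mono (fun ω h => by
      by_cases hA : ω ∈ A
      · exact Or.inr hA
      · exact Or.inl ((hs ω hA).2 h))).trans (measureReal_union_le s A)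
  rw [abs_le]
  constructor <;> linarith

/-- Two events which agree with independent events outside `A` and `B` respectively have
covariance at most `2 (μ A + μ B)`. -/
lemma abs_cov_le_of_approx_indep {Ω : Type*} {mΩ : MeasurableSpace Ω} {μ : Measure Ω}
    [IsProbabilityMeasure μ] {s t s' t' A B : Set Ω}
    (hs : ∀ ω ∉ A, (ω ∈ s ↔ ω ∈ s')) (ht : ∀ ω ∉ B, (ω ∈ t ↔ ω ∈ t'))
    (hind : μ.real (s' ∩ t') = μ.real s' * μ.real t') :
    |μ.real (s ∩ t) - μ.real s * μ.real t| ≤ 2 * (μ.real A + μ.real B) := by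
  have h1 : |μ.real (s ∩ t) - μ.real (s' ∩ t')| ≤ μ.real A + μ.real B :=
    (abs_measureReal_sub_le_of_iff (A := A ∪ B) fun ω hω => by
      rw [Set.mem_union, not_or] at hω
      exact and_congr (hs ω hω.1) (ht ω hω.2)).trans (measureReal_union_le A B)
  have h2 : |μ.real s - μ.real s'| ≤ μ.real A := abs_measureReal_sub_le_of_iff hs
  have h3 : |μ.real t - μ.real t'| ≤ μ.real B := abs_measureReal_sub_le_of_iff ht
  have h4 : |(μ.real s' - μ.real s) * μ.real t'| ≤ μ.real A := by
    rw [abs_mul, abs_sub_comm, abs_of_nonneg (measureReal_nonneg (s := t'))]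
    exact (mul_le_of_le_one_right (abs_nonneg _) measureReal_le_one).trans h2
  have h5 : |μ.real s * (μ.real t' - μ.real t)| ≤ μ.real B := by
    rw [abs_mul, abs_sub_comm (μ.real t'), abs_of_nonneg (measureReal_nonneg (s := s))]
    exact (mul_le_of_le_one_left (abs_nonneg _) measureReal_le_one).trans h3
  rw [hind] at h1
  rw [abs_le] at *
  constructor <;> nlinarith

lemma measure_window_eq_prod {Ω : Type*} {mΩ : MeasurableSpace Ω} {μ : Measure Ω}
    {e : ℤ → Ω → ℝ} (he : ∀ n, Measurable (e n)) (hindep : iIndepFun e μ)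
    (hident : ∀ n, Measure.map (e n) μ = Measure.map (e 0) μ)
    {S : ℕ → Set ℝ} (hS : ∀ i, MeasurableSet (S i)) (N : ℕ) (n : ℤ) :
    μ {ω | ∀ i ∈ Finset.range N, e (n - i) ω ∈ S i}
      = ∏ i ∈ Finset.range N, Measure.map (e 0) μ (S i) := by
  have hinj : Function.Injective fun i : ℕ => n - (i : ℤ) := fun i j h => by
    simpa using h
  have h := (hindep.precomp hinj).meas_biInter (S := Finset.range N)
    (s := fun i => e (n - i) ⁻¹' S i) (fun i _ => ⟨S i, hS i, rfl⟩)
  have hset : {ω | ∀ i ∈ Finset.range N, e (n - i) ω ∈ S i}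
      = ⋂ i ∈ Finset.range N, e (n - i) ⁻¹' S i := by
    ext ω; simp
  rw [hset, h]
  refine Finset.prod_congr rfl fun i _ => ?_
  rw [← Measure.map_apply (he _) (hS i), hident]

/-- If each event `Q n` has probability at least `c` and depends only on the noise in
`(n - D, n]`, then none of `Q n, Q (n - D), …, Q (n - (M - 1) D)` occurs with probability at
most `(1 - c) ^ M`. -/
lemma measureReal_forall_notMem_le_pow {Ω : Type*} {mΩ : MeasurableSpace Ω} {μ : Measure Ω}
    [IsProbabilityMeasure μ] {e : ℤ → Ω → ℝ} (he : ∀ n, Measurable (e n))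
    (hindep : iIndepFun e μ) {D : ℕ} {Q : ℤ → Set Ω}
    (hQ : ∀ n, MeasurableSet[noiseSigma e (Set.Ioc (n - D) n)] (Q n))
    {c : ℝ} (hcQ : ∀ n, c ≤ μ.real (Q n)) (n : ℤ) (M : ℕ) :
    μ.real {ω | ∀ t < M, ω ∉ Q (n - (t : ℤ) * D)} ≤ (1 - c) ^ M := by
  have hc1 : 0 ≤ 1 - c := sub_nonneg.2 ((hcQ 0).trans measureReal_le_one)
  induction M with
  | zero => simp
  | succ M ih =>
    have hset : {ω | ∀ t < M + 1, ω ∉ Q (n - (t : ℤ) * D)}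
        = {ω | ∀ t < M, ω ∉ Q (n - (t : ℤ) * D)} ∩ (Q (n - (M : ℤ) * D))ᶜ := by
      ext ω
      simp [Nat.le_iff_lt_or_eq, or_imp, forall_and]
    have hmeas : MeasurableSet[noiseSigma e (Set.Ioi (n - (M : ℤ) * D))]
        {ω | ∀ t < M, ω ∉ Q (n - (t : ℤ) * D)} := by
      have : {ω | ∀ t < M, ω ∉ Q (n - (t : ℤ) * D)}
          = ⋂ t ∈ Set.Iio M, (Q (n - (t : ℤ) * D))ᶜ := by
        ext ω; simp
      rw [this]
      refine MeasurableSet.biInter (Set.to_countable _) fun t ht => ?_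
      refine (noiseSigma_mono e (fun j hj => ?_) _ (hQ (n - (t : ℤ) * D))).compl
      have h1 : ((t : ℤ) + 1) * D ≤ M * D := by
        have : t + 1 ≤ M := ht
        exact_mod_cast Nat.mul_le_mul_right D this
      have := hj.1
      simp only [Set.mem_Ioi]
      linarith
    have hdisj : Disjoint (Set.Ioi (n - (M : ℤ) * D))
        (Set.Ioc (n - (M : ℤ) * D - D) (n - (M : ℤ) * D)) :=
      Set.disjoint_left.2 fun j h1 h2 => absurd h2.2 (not_le.2 h1)
    have hle : noiseSigma e (Set.Ioc (n - (M : ℤ) * D - D) (n - (M : ℤ) * D)) ≤ mΩ :=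
      iSup₂_le fun i _ => (he i).comap_le
    rw [hset, measureReal_inter_of_noiseSigma he hindep hdisj hmeas (hQ _).compl, pow_succ]
    refine mul_le_mul ih ?_ measureReal_nonneg (pow_nonneg hc1 M)
    rw [probReal_compl_eq_one_sub (hle _ (hQ _))]
    linarith [hcQ (n - (M : ℤ) * D)]

lemma measurable_truncated_tma {Ω : Type*} [MeasurableSpace Ω] {e : ℤ → Ω → ℝ} {q d : ℕ}
    {r μ1 μ2 : ℝ} {φ ψ : ℕ → ℝ} {a b U W : ℤ → Ω → ℝ}
    (ha : ∀ n ω, a n ω = μ2 + e n ω + ∑ i ∈ Finset.Icc 1 q, ψ i * e (n - i) ω)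
    (hb : ∀ n ω, b n ω = μ1 + e n ω + ∑ i ∈ Finset.Icc 1 q, φ i * e (n - i) ω)
    (hU : ∀ n ω, U n ω = if a n ω ≤ r then 1 else 0)
    (hW : ∀ n ω, W n ω = (if b n ω ≤ r then 1 else 0) - (if a n ω ≤ r then 1 else 0))
    (n : ℤ) (m : ℕ)
    (he : ∀ j ∈ Set.Icc (n - (m : ℤ) * d - q) n, Measurable (e j)) :
    Measurable fun ω => a n ω + (b n ω - a n ω) * ∑ j ∈ Finset.range m,
      (∏ s ∈ Finset.range j, W (n - d - (s : ℤ) * d) ω) * U (n - d - (j : ℤ) * d) ω := by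
  have hlin (θ : ℕ → ℝ) (ν : ℝ) (l : ℤ) (h1 : n - (m : ℤ) * d ≤ l) (h2 : l ≤ n) :
      Measurable fun ω => ν + e l ω + ∑ i ∈ Finset.Icc 1 q, θ i * e (l - i) ω := by
    refine ((he l ⟨by linarith, h2⟩).const_add ν).add
      (Finset.measurable_sum _ fun i hi => (he _ ?_).const_mul _)
    have := (Finset.mem_Icc.1 hi).2
    constructor <;> lia
  have hma (l : ℤ) (h1 : n - (m : ℤ) * d ≤ l) (h2 : l ≤ n) : Measurable (a l) := by
    rw [funext (ha l)]; exact hlin ψ μ2 l h1 h2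
  have hmb (l : ℤ) (h1 : n - (m : ℤ) * d ≤ l) (h2 : l ≤ n) : Measurable (b l) := by
    rw [funext (hb l)]; exact hlin φ μ1 l h1 h2
  have hmU (l : ℤ) (h1 : n - (m : ℤ) * d ≤ l) (h2 : l ≤ n) : Measurable (U l) := by
    rw [funext (hU l)]
    exact Measurable.ite (measurableSet_le (hma l h1 h2) measurable_const)
      measurable_const measurable_const
  have hmW (l : ℤ) (h1 : n - (m : ℤ) * d ≤ l) (h2 : l ≤ n) : Measurable (W l) := by
    rw [funext (hW l)]
    exact (Measurable.ite (measurableSet_le (hmb l h1 h2) measurable_const)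
      measurable_const measurable_const).sub
      (Measurable.ite (measurableSet_le (hma l h1 h2) measurable_const)
      measurable_const measurable_const)
  have hbd (s : ℕ) (hs : s < m) : n - (m : ℤ) * d ≤ n - d - (s : ℤ) * d := by
    have : ((s : ℤ) + 1) * d ≤ m * d := by exact_mod_cast Nat.mul_le_mul_right d hs
    linarith
  have hup (s : ℕ) : n - d - (s : ℤ) * d ≤ n := by
    have : (0 : ℤ) ≤ (s : ℤ) * d := by positivity
    linarith [Int.natCast_nonneg d]
  have hn : n - (m : ℤ) * d ≤ n := by
    have : (0 : ℤ) ≤ (m : ℤ) * d := by positivity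
    linarith
  refine (hma n hn le_rfl).add (((hmb n hn le_rfl).sub (hma n hn le_rfl)).mul
    (Finset.measurable_sum _ fun j hj => ?_))
  have hj := Finset.mem_range.1 hj
  refine (Finset.measurable_prod _ fun s hs => ?_).mul (hmU _ (hbd j hj) (hup j))
  have hs := Finset.mem_range.1 hs
  exact hmW _ (hbd s (hs.trans hj)) (hup s)

lemma tsum_prod_mul_eq_sum_range {W U : ℕ → ℝ} {s m : ℕ} (hs : s < m) (h : W s = 0) :
    ∑' j : ℕ, (∏ i ∈ Finset.range j, W i) * U j
      = ∑ j ∈ Finset.range m, (∏ i ∈ Finset.range j, W i) * U j := by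
  refine tsum_eq_sum fun j hj => ?_
  rw [Finset.prod_eq_zero (Finset.mem_range.2 (hs.trans_le (not_lt.1
    (fun h' => hj (Finset.mem_range.2 h'))))) h, zero_mul]

lemma integral_eq_measureReal_of_eq_one_zero {Ω : Type*} {mΩ : MeasurableSpace Ω}
    {μ : Measure Ω} {s : Set Ω} (hs : NullMeasurableSet s μ) {g : Ω → ℝ}
    (h1 : ∀ ω ∈ s, g ω = 1) (h0 : ∀ ω ∉ s, g ω = 0) : ∫ ω, g ω ∂μ = μ.real s := by
  have hg : g = s.indicator 1 := by
    ext ω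
    by_cases hω : ω ∈ s
    · rw [h1 ω hω, Set.indicator_of_mem hω, Pi.one_apply]
    · rw [h0 ω hω, Set.indicator_of_notMem hω]
  rw [hg, integral_indicator₀ hs]
  simp

lemma exists_linear_combination_le {q : ℕ} (r ν : ℝ) (θ : ℕ → ℝ) :
    ∃ K : ℝ, ∀ (x : ℝ) (z : ℕ → ℝ), x ≤ K → (∀ i ∈ Finset.Icc 1 q, |z i| ≤ 1) →
      ν + x + ∑ i ∈ Finset.Icc 1 q, θ i * z i ≤ r := by
  refine ⟨r - ν - ∑ i ∈ Finset.Icc 1 q, |θ i|, fun x z hx hz => ?_⟩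
  have : ∑ i ∈ Finset.Icc 1 q, θ i * z i ≤ ∑ i ∈ Finset.Icc 1 q, |θ i| := by
    refine Finset.sum_le_sum fun i hi => (le_abs_self _).trans ?_
    rw [abs_mul]
    exact mul_le_of_le_one_right (abs_nonneg _) (hz i hi)
  linarith

/-- If the i.i.d. noise has a continuous, bounded and strictly
positive density on ℝ, then for the unique strictly stationary solution `{y_n}`
of the TMA(q) model there exist `ρ ∈ (0,1)` and `C > 0` such that for all
(possibly infinite) endpoints `u1 < u2`, `v1 < v2` and all `k ≥ 1`,
`|Cov(1(u1 < y_0 ≤ u2), 1(v1 < y_k ≤ v2))| ≤ C·ρ^k`. -/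
theorem tma_interval_indicator_cov_decay
    {Ω : Type*} [MeasureSpace Ω] [IsProbabilityMeasure (ℙ : Measure Ω)]
    (e : ℤ → Ω → ℝ)
    (he : ∀ n, Measurable (e n))
    (hindep : iIndepFun e ℙ)
    (hident : ∀ n, Measure.map (e n) ℙ = Measure.map (e 0) ℙ)
    (f : ℝ → ℝ)
    (hf_cont : Continuous f)
    (hf_pos : ∀ x, 0 < f x)
    (hf_bdd : ∃ M, ∀ x, f x ≤ M)
    (hf_law : Measure.map (e 0) ℙ
      = (volume : Measure ℝ).withDensity fun x => ENNReal.ofReal (f x))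
    (q d : ℕ) (hq : 0 < q) (hd : 0 < d)
    (r μ1 μ2 : ℝ) (φ ψ : ℕ → ℝ)
    (a b U W : ℤ → Ω → ℝ)
    (ha : ∀ n ω, a n ω = μ2 + e n ω + ∑ i ∈ Finset.Icc 1 q, ψ i * e (n - i) ω)
    (hb : ∀ n ω, b n ω = μ1 + e n ω + ∑ i ∈ Finset.Icc 1 q, φ i * e (n - i) ω)
    (hU : ∀ n ω, U n ω = if a n ω ≤ r then 1 else 0)
    (hW : ∀ n ω, W n ω = (if b n ω ≤ r then 1 else 0) - (if a n ω ≤ r then 1 else 0))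
    (α : ℤ → Ω → ℝ)
    (hα : ∀ n ω, α n ω =
      ∑' j : ℕ, (∏ s ∈ Finset.range j, W (n - (s : ℤ) * d) ω) * U (n - (j : ℤ) * d) ω)
    (y : ℤ → Ω → ℝ)
    (hy : ∀ n ω, y n ω = a n ω + (b n ω - a n ω) * α (n - d) ω) :
    ∃ ρ ∈ Set.Ioo (0 : ℝ) 1, ∃ C > (0 : ℝ),
      ∀ u1 u2 v1 v2 : EReal, u1 < u2 → v1 < v2 → ∀ k : ℕ, 1 ≤ k →
        |(∫ ω, (if u1 < (y 0 ω : EReal) ∧ (y 0 ω : EReal) ≤ u2 then (1 : ℝ) else 0)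
              * (if v1 < (y (k : ℤ) ω : EReal) ∧ (y (k : ℤ) ω : EReal) ≤ v2
                  then (1 : ℝ) else 0) ∂ℙ)
            - (∫ ω, (if u1 < (y 0 ω : EReal) ∧ (y 0 ω : EReal) ≤ u2
                  then (1 : ℝ) else 0) ∂ℙ)
              * (∫ ω, (if v1 < (y (k : ℤ) ω : EReal) ∧ (y (k : ℤ) ω : EReal) ≤ v2
                  then (1 : ℝ) else 0) ∂ℙ)|
          ≤ C * ρ ^ k := by
  obtain ⟨K₁, hK₁⟩ := exists_linear_combination_le (q := q) r μ1 φ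
  obtain ⟨K₂, hK₂⟩ := exists_linear_combination_le (q := q) r μ2 ψ
  let S : ℕ → Set ℝ := fun i => if i = 0 then Set.Iic (min K₁ K₂) else Set.Icc (-1) 1
  have hSm (i : ℕ) : MeasurableSet (S i) := by
    by_cases hi : i = 0
    · simp [S, hi]
    · simp [S, hi]
  have hS0 (i : ℕ) : Measure.map (e 0) ℙ (S i) ≠ 0 := by
    have hac : (volume : Measure ℝ) ≪ Measure.map (e 0) ℙ := by
      rw [hf_law]
      exact withDensity_absolutelyContinuous'
        (hf_cont.measurable.ennreal_ofReal).aemeasurable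
        (Eventually.of_forall fun x => by simpa using hf_pos x)
    intro h0
    have := hac h0
    by_cases hi : i = 0
    · simp [S, hi] at this
    · simp [S, hi] at this
      norm_num at this
  let Q : ℤ → Set Ω := fun n => {ω | ∀ i ∈ Finset.range (q + 1), e (n - i) ω ∈ S i}
  have hQW (n : ℤ) (ω : Ω) (hω : ω ∈ Q n) : W n ω = 0 := by
    have h0 : e n ω ≤ min K₁ K₂ := by simpa [S] using hω 0 (by simp)
    have hz : ∀ i ∈ Finset.Icc 1 q, |e (n - i) ω| ≤ 1 := fun i hi => by
      have hi := Finset.mem_Icc.1 hi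
      have := hω i (Finset.mem_range.2 (by lia))
      have hi0 : i ≠ 0 := by lia
      simp only [S, hi0, if_false] at this
      exact abs_le.2 this
    have hbr : b n ω ≤ r := by
      rw [hb]; exact hK₁ _ (fun i => e (n - i) ω) (h0.trans (min_le_left _ _)) hz
    have har : a n ω ≤ r := by
      rw [ha]; exact hK₂ _ (fun i => e (n - i) ω) (h0.trans (min_le_right _ _)) hz
    simp [hW, hbr, har]
  set D : ℕ := (q + 1) * d with hD
  have hqD : q + 1 ≤ D := Nat.le_mul_of_pos_right _ hd
  have hQm (n : ℤ) : MeasurableSet[noiseSigma e (Set.Ioc (n - D) n)] (Q n) := by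
    have : Q n = ⋂ i ∈ Finset.range (q + 1), e (n - i) ⁻¹' S i := by
      ext ω; simp [Q]
    rw [this]
    refine Finset.measurableSet_biInter _ fun i hi => ?_
    have hi := Finset.mem_range.1 hi
    have hmem : n - (i : ℤ) ∈ Set.Ioc (n - (D : ℤ)) n := ⟨by lia, by lia⟩
    exact measurable_noiseSigma e hmem (hSm i)
  obtain ⟨c, hc0, hc1, hcQ⟩ : ∃ c : ℝ, 0 < c ∧ c < 1 ∧ ∀ n, c ≤ (ℙ : Measure Ω).real (Q n) := by
    have heq (n : ℤ) : (ℙ : Measure Ω).real (Q n) = (ℙ : Measure Ω).real (Q 0) := by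
      simp only [Measure.real, Q, measure_window_eq_prod he hindep hident hSm]
    have hpos : 0 < (ℙ : Measure Ω).real (Q 0) := by
      refine ENNReal.toReal_pos ?_ (measure_ne_top _ _)
      rw [measure_window_eq_prod he hindep hident hSm]
      exact Finset.prod_ne_zero_iff.2 fun i _ => hS0 i
    have hle : (ℙ : Measure Ω).real (Q 0) ≤ 1 := measureReal_le_one
    exact ⟨(ℙ : Measure Ω).real (Q 0) / 2, by linarith, by linarith,
      fun n => by rw [heq n]; linarith⟩
  let A : ℤ → ℕ → Set Ω := fun n M => {ω | ∀ t < M, ω ∉ Q (n - d - (t : ℤ) * D)}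
  have hA (n : ℤ) (M : ℕ) : (ℙ : Measure Ω).real (A n M) ≤ (1 - c) ^ M :=
    measureReal_forall_notMem_le_pow he hindep hQm hcQ (n - d) M
  let yT : ℕ → ℤ → Ω → ℝ := fun M n ω => a n ω + (b n ω - a n ω) *
    ∑ j ∈ Finset.range (M * (q + 1)),
      (∏ s ∈ Finset.range j, W (n - d - (s : ℤ) * d) ω) * U (n - d - (j : ℤ) * d) ω
  have hyT (M : ℕ) (n : ℤ) (ω : Ω) (hω : ω ∉ A n M) : y n ω = yT M n ω := by
    simp only [A, Set.mem_ofPred_eq, not_forall, not_not] at hω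
    obtain ⟨t, ht, hω⟩ := hω
    have h0 := hQW _ _ hω
    rw [hy, hα]
    simp only [yT]
    rw [tsum_prod_mul_eq_sum_range (W := fun s : ℕ => W (n - d - (s : ℤ) * d) ω)
      (U := fun j : ℕ => U (n - d - (j : ℤ) * d) ω) (s := t * (q + 1)) (m := M * (q + 1))
      (Nat.mul_lt_mul_of_pos_right ht (Nat.succ_pos q))]
    convert h0 using 2
    rw [hD]
    push_cast
    ring
  have hyTm (M : ℕ) (n : ℤ) {T : Set ℤ} (hT : Set.Icc (n - (M : ℤ) * D - q) n ⊆ T) :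
      Measurable[noiseSigma e T] (yT M n) := by
    refine @measurable_truncated_tma Ω (noiseSigma e T) e q d r μ1 μ2 φ ψ a b U W ha hb hU hW n
      (M * (q + 1)) fun j hj => measurable_noiseSigma e (hT ?_)
    rw [hD]
    push_cast at hj ⊢
    rwa [← mul_assoc]
  have hle (T : Set ℤ) : noiseSigma e T ≤ (inferInstance : MeasurableSpace Ω) :=
    iSup₂_le fun i _ => (he i).comap_le
  have hAanti (n : ℤ) {M M' : ℕ} (h : M ≤ M') : A n M' ⊆ A n M :=
    fun ω hω t ht => hω t (ht.trans_le h)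
  have hym (n : ℤ) : AEMeasurable (y n) ℙ := by
    have hnull : (ℙ : Measure Ω) (⋂ M, A n M) = 0 := by
      rw [← measureReal_eq_zero_iff]
      refine le_antisymm (ge_of_tendsto' (tendsto_pow_atTop_nhds_zero_of_lt_one
        (by linarith) (by linarith : 1 - c < 1)) fun M => ?_) measureReal_nonneg
      exact (measureReal_mono (Set.iInter_subset _ M)).trans (hA n M)
    refine aemeasurable_of_tendsto_metrizable_ae' (f := fun M => yT M n)
      (fun M => ((hyTm M n (Set.subset_univ _)).mono (hle _) le_rfl).aemeasurable) ?_
    filter_upwards [measure_eq_zero_iff_ae_notMem.1 hnull] with ω hω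
    simp only [Set.mem_iInter, not_forall] at hω
    obtain ⟨M, hM⟩ := hω
    refine tendsto_const_nhds.congr' ?_
    filter_upwards [eventually_ge_atTop M] with M' hM'
    exact hyT M' n ω fun h => hM (hAanti n hM' h)
  have hDpos : D ≠ 0 := by lia
  set ρ : ℝ := (1 - c) ^ ((D : ℝ)⁻¹) with hρ
  have hρD : ρ ^ D = 1 - c := Real.rpow_inv_natCast_pow (by linarith) hDpos
  have hρ0 : 0 < ρ := Real.rpow_pos_of_pos (by linarith) _
  have hρ1 : ρ < 1 := Real.rpow_lt_one (by linarith) (by linarith) (by positivity)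
  refine ⟨ρ, ⟨hρ0, hρ1⟩, 4 / ρ ^ (q + D), by positivity, ?_⟩
  intro u1 u2 v1 v2 _ _ k _
  let I : Set ℝ := Real.toEReal ⁻¹' Set.Ioc u1 u2
  let J : Set ℝ := Real.toEReal ⁻¹' Set.Ioc v1 v2
  have hI : MeasurableSet I := measurable_coe_real_ereal measurableSet_Ioc
  have hJ : MeasurableSet J := measurable_coe_real_ereal measurableSet_Ioc
  have hs : NullMeasurableSet (y 0 ⁻¹' I) ℙ := (hym 0).nullMeasurable hI
  have ht : NullMeasurableSet (y k ⁻¹' J) ℙ := (hym k).nullMeasurable hJ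
  have hyI (ω : Ω) : ω ∈ y 0 ⁻¹' I ↔ u1 < (y 0 ω : EReal) ∧ (y 0 ω : EReal) ≤ u2 := Iff.rfl
  have hyJ (ω : Ω) : ω ∈ y k ⁻¹' J ↔ v1 < (y k ω : EReal) ∧ (y k ω : EReal) ≤ v2 := Iff.rfl
  rw [integral_eq_measureReal_of_eq_one_zero (hs.inter ht)
      (fun ω hω => by rw [if_pos ((hyI ω).1 hω.1), if_pos ((hyJ ω).1 hω.2), one_mul])
      (fun ω hω => by
        rw [Set.mem_inter_iff, not_and_or] at hω
        rcases hω with h | h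
        · rw [if_neg (mt (hyI ω).2 h), zero_mul]
        · rw [if_neg (mt (hyJ ω).2 h), mul_zero]),
    integral_eq_measureReal_of_eq_one_zero hs (fun ω hω => if_pos ((hyI ω).1 hω))
      (fun ω hω => if_neg (mt (hyI ω).2 hω)),
    integral_eq_measureReal_of_eq_one_zero ht (fun ω hω => if_pos ((hyJ ω).1 hω))
      (fun ω hω => if_neg (mt (hyJ ω).2 hω))]
  have key (M : ℕ) (h : M = 0 ∨ M * D + q < k) :
      |(ℙ : Measure Ω).real (y 0 ⁻¹' I ∩ y k ⁻¹' J)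
        - (ℙ : Measure Ω).real (y 0 ⁻¹' I) * (ℙ : Measure Ω).real (y k ⁻¹' J)|
        ≤ 4 * ρ ^ (D * M) := by
    have hbound : 2 * ((ℙ : Measure Ω).real (A 0 M) + (ℙ : Measure Ω).real (A k M))
        ≤ 4 * ρ ^ (D * M) := by
      rw [pow_mul, hρD]
      linarith [hA 0 M, hA k M]
    refine le_trans ?_ hbound
    rcases h with rfl | h
    · exact abs_cov_le_of_approx_indep (s' := ∅) (t' := ∅) (by simp [A]) (by simp [A]) (by simp)
    · refine abs_cov_le_of_approx_indep (s' := yT M 0 ⁻¹' I) (t' := yT M k ⁻¹' J)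
        (fun ω hω => by simp only [Set.mem_preimage, hyT M 0 ω hω])
        (fun ω hω => by simp only [Set.mem_preimage, hyT M k ω hω])
        (measureReal_inter_of_noiseSigma he hindep (S := Set.Iic 0) (T := Set.Ioi 0)
          (Set.disjoint_left.2 fun j h1 h2 => absurd (Set.mem_Iic.1 h1) (not_le.2 h2))
          (hyTm M 0 (fun j hj => hj.2) hI) (hyTm M k (fun j hj => ?_) hJ))
      have h1 : (M : ℤ) * D + q < k := by exact_mod_cast h
      have h2 := hj.1
      simp only [Set.mem_Ioi]
      linarith
  have hdiv := Nat.div_add_mod (k - q - 1) D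
  have hmod := Nat.mod_lt (k - q - 1) (Nat.pos_of_ne_zero hDpos)
  refine (key ((k - q - 1) / D) ?_).trans ?_
  · by_cases hkq : k ≤ q
    · left
      rw [show k - q - 1 = 0 by lia, Nat.zero_div]
    · right
      rw [mul_comm]
      lia
  · rw [div_mul_eq_mul_div, le_div_iff₀ (by positivity), mul_assoc, ← pow_add]
    refine mul_le_mul_of_nonneg_left (pow_le_pow_of_le_one hρ0.le hρ1.le ?_) (by norm_num)
    lia
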